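/- Assume Hypothesis (H2), let β ≥ 0, let C_HP > 0 be a constant such that ∫_0^1 v²/σ ≤ C_HP ∫_0^1 (v')² for all v ∈ H¹_{1/σ,0}(0,1), and let y be a classical solution of the damped degenerate wave equation. Set Θ := max{1/a(1) + K·C_HP/min_{[0,1]} η, 1 + K/4}. Then for every T > s > 0, with Q_s = (s,T)×(0,1): (ε₀/2) ∫∫_{Q_s} (y_t²/σ + η y_x²) dx dt ≤ 4Θ E_y(s) + (1/σ(1) + 1/η(1) + β/η(1) + K/4)(E_y(s) − E_y(T)) + (β²/η(1) + Kβ/2 + β/η(1) + K/4) ∫_s^T y(t,1)² dt. -/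

import Mathlib

open MeasureTheory Set Filter Topology

/-- The Feller weight `η(x) = exp (∫_{1/2}^x b/a)`. -/
noncomputable def etaW (a b : ℝ → ℝ) (x : ℝ) : ℝ :=
  Real.exp (∫ s in (1/2 : ℝ)..x, b s / a s)

/-- The weight `σ = a / η`. -/
noncomputable def sigW (a b : ℝ → ℝ) (x : ℝ) : ℝ :=
  a x / etaW a b x

/-- `u ∈ H¹(0,1)` with (a.e.) derivative `u'`. -/
structure MemH1 (u u' : ℝ → ℝ) : Prop where
  cont : ContinuousOn u (Set.Icc 0 1)
  hasDeriv : ∀ᵐ x ∂(volume.restrict (Set.Ioo (0:ℝ) 1)), HasDerivAt u (u' x) x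
  deriv_sq_int : IntegrableOn (fun x => (u' x) ^ 2) (Set.Ioo (0:ℝ) 1)
  ftc : ∀ x ∈ Set.Icc (0:ℝ) 1, u x = u 0 + ∫ t in Set.Ioo (0:ℝ) x, u' t

/-- `u ∈ L²_{1/σ}(0,1)`. -/
def MemL2sig (a b u : ℝ → ℝ) : Prop :=
  IntegrableOn (fun x => (u x) ^ 2) (Set.Ioo (0:ℝ) 1) ∧
  IntegrableOn (fun x => (u x) ^ 2 / sigW a b x) (Set.Ioo (0:ℝ) 1)

/-- `u ∈ H¹_{1/σ}(0,1)`. -/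
structure MemH1sig (a b u u' : ℝ → ℝ) extends MemH1 u u' : Prop where
  l2sig : MemL2sig a b u

/-- `u ∈ H¹_{1/σ,0}(0,1)`. -/
structure MemH1sig0 (a b u u' : ℝ → ℝ) extends MemH1sig a b u u' : Prop where
  zero : u 0 = 0

/-- `u ∈ H²_{1/σ}(0,1)`: `η u'` is locally absolutely continuous on `(0,1]`
with derivative `w`, and `Au = σ (η u')' = σ w ∈ L²_{1/σ}`. -/
structure MemH2sig (a b u u' w : ℝ → ℝ) extends MemH1sig a b u u' : Prop where
  w_locint : ∀ c ∈ Set.Ioc (0:ℝ) 1, IntegrableOn w (Set.Icc c 1)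
  locAC : ∀ c ∈ Set.Ioc (0:ℝ) 1, ∀ x ∈ Set.Icc c 1,
    etaW a b x * u' x = etaW a b c * u' c + ∫ t in Set.Ioo c x, w t
  Au_l2sig : MemL2sig a b (fun x => sigW a b x * w x)

/-- `u ∈ H²_{1/σ,0}(0,1)`. -/
structure MemH2sig0 (a b u u' w : ℝ → ℝ) extends MemH2sig a b u u' w : Prop where
  zero : u 0 = 0

/-- Hypothesis (H0): there is `K > 0` such that `x ↦ x^K / a x` is nondecreasing
in a right neighborhood of `0`. -/
def HypH0K (a : ℝ → ℝ) (K : ℝ) : Prop :=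
  0 < K ∧ ∃ ε > (0:ℝ), ∀ x y : ℝ, 0 < x → x ≤ y → y ≤ ε →
    x ^ K / a x ≤ y ^ K / a y

def HypH0 (a : ℝ → ℝ) : Prop := ∃ K : ℝ, HypH0K a K

/-- `a` is weakly degenerate at `0` with constant
`K = sup_{x ∈ (0,1]} x|a'(x)|/a(x) ∈ (0,1)`. -/
def IsWD (a a' : ℝ → ℝ) (K : ℝ) : Prop :=
  ContinuousOn a (Set.Icc 0 1) ∧ a 0 = 0 ∧ (∀ x ∈ Set.Ioc (0:ℝ) 1, 0 < a x) ∧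
  (∀ x ∈ Set.Ioc (0:ℝ) 1, HasDerivAt a (a' x) x) ∧
  ContinuousOn a' (Set.Ioc 0 1) ∧
  IsLUB ((fun x => x * |a' x| / a x) '' Set.Ioc (0:ℝ) 1) K ∧ 0 < K ∧ K < 1

/-- `a` is strongly degenerate at `0` with constant
`K = sup_{x ∈ (0,1]} x|a'(x)|/a(x) ∈ [1,2)`. -/
def IsSD (a a' : ℝ → ℝ) (K : ℝ) : Prop :=
  ContinuousOn a (Set.Icc 0 1) ∧ a 0 = 0 ∧ (∀ x ∈ Set.Ioc (0:ℝ) 1, 0 < a x) ∧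
  (∀ x ∈ Set.Icc (0:ℝ) 1, HasDerivWithinAt a (a' x) (Set.Icc 0 1) x) ∧
  ContinuousOn a' (Set.Icc 0 1) ∧
  IsLUB ((fun x => x * |a' x| / a x) '' Set.Ioc (0:ℝ) 1) K ∧ 1 ≤ K ∧ K < 2

/-- Hypothesis (H1): `b/a ∈ L¹(0,1)`, `b` continuous, `a` is (WD) or (SD) with
constant `K`, and if `K > 1` then `x b(x)/a(x) ∈ L^∞(0,1)`. -/
def HypH1 (a a' b : ℝ → ℝ) (K : ℝ) : Prop :=
  (IsWD a a' K ∨ IsSD a a' K) ∧ ContinuousOn b (Set.Icc 0 1) ∧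
  MeasureTheory.IntegrableOn (fun x => b x / a x) (Set.Ioo (0:ℝ) 1) ∧
  (1 < K → ∃ M : ℝ, ∀ x ∈ Set.Ioo (0:ℝ) 1, |x * b x / a x| ≤ M)

/-- Hypothesis (H2): (H1) and `(2-K) a(x) - 2x|b(x)| ≥ ε₀ a(x)` on `[0,1]`. -/
def HypH2 (a a' b : ℝ → ℝ) (K ε₀ : ℝ) : Prop :=
  HypH1 a a' b K ∧ 0 < ε₀ ∧
  ∀ x ∈ Set.Icc (0:ℝ) 1, ε₀ * a x ≤ (2 - K) * a x - 2 * x * |b x|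

/-- A classical solution of the damped degenerate wave equation
`y_tt = a y_xx + b y_x`, `y(t,0) = 0`, `y_t(t,1) + η(1) y_x(t,1) + β y(t,1) = 0`,
with the regularity, integrability and differentiation-under-the-integral
properties required of classical solutions. -/
structure ClassicalSol (a b : ℝ → ℝ) (β : ℝ)
    (y yt yx ytt ytx yxx : ℝ → ℝ → ℝ) : Prop where
  dt : ∀ t x, 0 ≤ t → x ∈ Set.Icc (0:ℝ) 1 → HasDerivAt (fun s => y s x) (yt t x) t
  dtt : ∀ t x, 0 ≤ t → x ∈ Set.Icc (0:ℝ) 1 → HasDerivAt (fun s => yt s x) (ytt t x) t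
  dx : ∀ t x, 0 ≤ t → x ∈ Set.Ioc (0:ℝ) 1 → HasDerivAt (fun ξ => y t ξ) (yx t x) x
  dtx : ∀ t x, 0 ≤ t → x ∈ Set.Ioc (0:ℝ) 1 → HasDerivAt (fun ξ => yt t ξ) (ytx t x) x
  dxx : ∀ t x, 0 ≤ t → x ∈ Set.Ioc (0:ℝ) 1 → HasDerivAt (fun ξ => yx t ξ) (yxx t x) x
  cont_tt : ContinuousOn (Function.uncurry ytt) (Set.Ici 0 ×ˢ Set.Ioc (0:ℝ) 1)
  cont_tx : ContinuousOn (Function.uncurry ytx) (Set.Ici 0 ×ˢ Set.Ioc (0:ℝ) 1)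
  cont_xx : ContinuousOn (Function.uncurry yxx) (Set.Ici 0 ×ˢ Set.Ioc (0:ℝ) 1)
  pde : ∀ t x, 0 < t → x ∈ Set.Ioo (0:ℝ) 1 → ytt t x = a x * yxx t x + b x * yx t x
  bc0 : ∀ t, 0 ≤ t → y t 0 = 0
  bc1 : ∀ t, 0 < t → yt t 1 + etaW a b 1 * yx t 1 + β * y t 1 = 0
  regx : ∀ t, 0 ≤ t → MemH2sig0 a b (y t) (yx t)
    (fun x => etaW a b x * (b x / a x * yx t x + yxx t x))
  regt : ∀ t, 0 ≤ t → MemH1sig0 a b (yt t) (ytx t)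
  ediff : ∀ t, 0 ≤ t → HasDerivAt
    (fun s => ∫ x in Set.Ioo (0:ℝ) 1,
      ((yt s x) ^ 2 / sigW a b x + etaW a b x * (yx s x) ^ 2))
    (∫ x in Set.Ioo (0:ℝ) 1,
      (2 * yt t x * ytt t x / sigW a b x + 2 * etaW a b x * yx t x * ytx t x)) t
  intQ : ∀ s T : ℝ, 0 < s → s < T →
    MeasureTheory.IntegrableOn
      (fun p : ℝ × ℝ => (yt p.1 p.2) ^ 2 / sigW a b p.2)
      (Set.Ioo s T ×ˢ Set.Ioo (0:ℝ) 1) ∧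
    MeasureTheory.IntegrableOn
      (fun p : ℝ × ℝ => etaW a b p.2 * (yx p.1 p.2) ^ 2)
      (Set.Ioo s T ×ˢ Set.Ioo (0:ℝ) 1)
  intBdry : ∀ s T : ℝ, 0 < s → s < T →
    MeasureTheory.IntegrableOn (fun t => (yt t 1) ^ 2) (Set.Ioo s T) ∧
    MeasureTheory.IntegrableOn (fun t => (yx t 1) ^ 2) (Set.Ioo s T) ∧
    MeasureTheory.IntegrableOn (fun t => (y t 1) ^ 2) (Set.Ioo s T)

/-- The energy of a solution `y`:
`E_y(t) = (1/2) [∫₀¹ (y_t²/σ + η y_x²) dx + β y(t,1)²]`. -/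
noncomputable def energy (a b : ℝ → ℝ) (β : ℝ) (y yt yx : ℝ → ℝ → ℝ) (t : ℝ) : ℝ :=
  (1/2) * ((∫ x in Set.Ioo (0:ℝ) 1,
    ((yt t x) ^ 2 / sigW a b x + etaW a b x * (yx t x) ^ 2)) + β * (y t 1) ^ 2)

/-- A function of `(t, x)` which is continuous in `x` and whose `t`-derivative is continuous on a
compact rectangle is jointly continuous there. -/
lemma continuousOn_rect_of_hasDerivAt {f g : ℝ → ℝ → ℝ} {s T c d : ℝ}
    (hd : ∀ t ∈ Icc s T, ∀ x ∈ Icc c d, HasDerivAt (fun r => f r x) (g t x) t)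
    (hf : ∀ t ∈ Icc s T, ContinuousOn (f t) (Icc c d))
    (hg : ContinuousOn (Function.uncurry g) (Icc s T ×ˢ Icc c d)) :
    ContinuousOn (Function.uncurry f) (Icc s T ×ˢ Icc c d) := by
  obtain ⟨C, hC⟩ := (isCompact_Icc.prod isCompact_Icc).exists_bound_of_continuousOn hg
  refine continuousOn_prod_of_continuousOn_lipschitzOnWith _ (Real.toNNReal C) hf ?_
  intro x hx
  refine Convex.lipschitzOnWith_of_nnnorm_hasDerivWithin_le (convex_Icc s T)
    (f' := fun t => g t x) (fun t ht => (hd t ht x hx).hasDerivWithinAt) ?_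
  intro t ht
  rw [← NNReal.coe_le_coe, coe_nnnorm]
  exact (hC (t, x) ⟨ht, hx⟩).trans (Real.le_coe_toNNReal C)

lemma exists_continuous_extension_rect {g : ℝ → ℝ → ℝ} {s T c d : ℝ} (hsT : s ≤ T) (hcd : c ≤ d)
    (hg : ContinuousOn (Function.uncurry g) (Icc s T ×ˢ Icc c d)) :
    ∃ G : ℝ → ℝ → ℝ, Continuous (Function.uncurry G) ∧
      ∀ t ∈ Icc s T, ∀ x ∈ Icc c d, G t x = g t x := by
  refine ⟨fun t x => g (max s (min T t)) (max c (min d x)), ?_, ?_⟩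
  · have h : Continuous fun p : ℝ × ℝ => (max s (min T p.1), max c (min d p.2)) := by fun_prop
    refine hg.comp_continuous h fun p => ⟨⟨le_max_left _ _, ?_⟩, ⟨le_max_left _ _, ?_⟩⟩
    · exact max_le hsT (min_le_left _ _)
    · exact max_le hcd (min_le_left _ _)
  · intro t ht x hx
    simp [ht.1, ht.2, hx.1, hx.2]

lemma intervalIntegral_swap_of_continuous {G : ℝ → ℝ → ℝ} (hG : Continuous (Function.uncurry G))
    (s T c d : ℝ) :
    ∫ t in s..T, ∫ x in c..d, G t x = ∫ x in c..d, ∫ t in s..T, G t x := by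
  refine intervalIntegral_intervalIntegral_swap ?_
  refine (hG.continuousOn.integrableOn_compact
    (isCompact_uIcc.prod isCompact_uIcc) (K := uIcc s T ×ˢ uIcc c d)).mono_set ?_
  exact prod_mono uIoc_subset_uIcc uIoc_subset_uIcc

lemma intervalIntegral_congr_Icc {f g : ℝ → ℝ} {c d : ℝ} (hcd : c ≤ d)
    (h : ∀ x ∈ Icc c d, f x = g x) : ∫ x in c..d, f x = ∫ x in c..d, g x :=
  intervalIntegral.integral_congr fun x hx => h x (by rwa [uIcc_of_le hcd] at hx)

/-- Integrated form over a rectangle of the pointwise inequality `∂ₜP + e ≤ ∂ₓR`. -/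
lemma integral_rect_le_of_deriv_le {P Pt e R : ℝ → ℝ → ℝ} {s T c d : ℝ} (hsT : s ≤ T)
    (hcd : c ≤ d)
    (hP : ∀ t ∈ Icc s T, ∀ x ∈ Icc c d, HasDerivAt (fun r => P r x) (Pt t x) t)
    (hPt : ContinuousOn (Function.uncurry Pt) (Icc s T ×ˢ Icc c d))
    (he : ContinuousOn (Function.uncurry e) (Icc s T ×ˢ Icc c d))
    (hR : ContinuousOn (Function.uncurry R) (Icc s T ×ˢ Icc c d))
    (hRd : ∀ t ∈ Icc s T, ∀ x ∈ Ioo c d,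
      ∃ R', HasDerivAt (R t) R' x ∧ Pt t x + e t x ≤ R') :
    (∫ x in c..d, (P T x - P s x)) + ∫ t in s..T, ∫ x in c..d, e t x ≤
      ∫ t in s..T, (R t d - R t c) := by
  obtain ⟨G, hG, hGe⟩ := exists_continuous_extension_rect hsT hcd hPt
  obtain ⟨H, hH, hHe⟩ := exists_continuous_extension_rect hsT hcd he
  have hGx : ∀ t, Continuous (G t) := fun t => hG.comp (Continuous.prodMk_right t)
  have hHx : ∀ t, Continuous (H t) := fun t => hH.comp (Continuous.prodMk_right t)
  have hGt : ∀ x, Continuous (fun t => G t x) := fun x => hG.comp (Continuous.prodMk_left x)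
  have hGi : Continuous fun t => ∫ x in c..d, G t x :=
    intervalIntegral.continuous_parametric_intervalIntegral_of_continuous' hG c d
  have hHi : Continuous fun t => ∫ x in c..d, H t x :=
    intervalIntegral.continuous_parametric_intervalIntegral_of_continuous' hH c d
  have h1 : ∫ x in c..d, (P T x - P s x) = ∫ t in s..T, ∫ x in c..d, G t x := by
    rw [intervalIntegral_swap_of_continuous hG]
    refine intervalIntegral_congr_Icc hcd fun x hx => ?_
    refine (intervalIntegral.integral_eq_sub_of_hasDerivAt (f := fun r => P r x)
      (fun t ht => ?_) ((hGt x).intervalIntegrable _ _)).symm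
    rw [uIcc_of_le hsT] at ht
    rw [hGe t ht x hx]
    exact hP t ht x hx
  have h2 : ∫ t in s..T, ∫ x in c..d, e t x = ∫ t in s..T, ∫ x in c..d, H t x :=
    intervalIntegral_congr_Icc hsT fun t ht =>
      intervalIntegral_congr_Icc hcd fun x hx => (hHe t ht x hx).symm
  rw [h1, h2, ← intervalIntegral.integral_add (hGi.intervalIntegrable _ _)
    (hHi.intervalIntegrable _ _)]
  have hRt : ∀ x ∈ Icc c d, ContinuousOn (fun t => R t x) (Icc s T) := fun x hx =>
    hR.comp (f := fun t => (t, x)) (by fun_prop) fun t ht => ⟨ht, hx⟩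
  have hRx : ∀ t ∈ Icc s T, ContinuousOn (R t) (Icc c d) := fun t ht =>
    hR.comp (f := fun x => (t, x)) (by fun_prop) fun x hx => ⟨ht, hx⟩
  refine intervalIntegral.integral_mono_on hsT ((hGi.add hHi).intervalIntegrable _ _) ?_ ?_
  · refine ContinuousOn.intervalIntegrable ?_
    rw [uIcc_of_le hsT]
    exact (hRt d (right_mem_Icc.2 hcd)).sub (hRt c (left_mem_Icc.2 hcd))
  · intro t ht
    rw [← intervalIntegral.integral_add ((hGx t).intervalIntegrable _ _)
      ((hHx t).intervalIntegrable _ _)]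
    choose! R' hR' hle using hRd t ht
    refine intervalIntegral.integral_le_sub_of_hasDeriv_right_of_le hcd (hRx t ht)
      (fun x hx => (hR' x hx).hasDerivWithinAt)
      ((hGx t).add (hHx t)).continuousOn.integrableOn_Icc fun x hx => ?_
    have hx' := Ioo_subset_Icc_self hx
    simpa [hGe t ht x hx', hHe t ht x hx'] using hle x hx

/-- If `∂ₜf` and `∂ₓ∂ₜf` are continuous, then `∂ₓf` has `t`-derivative `∂ₓ∂ₜf`. -/
lemma hasDerivAt_mixed {f ft fx ftx : ℝ → ℝ → ℝ}
    (hft : ∀ t x, 0 ≤ t → x ∈ Icc (0:ℝ) 1 → HasDerivAt (fun r => f r x) (ft t x) t)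
    (hfx : ∀ t x, 0 ≤ t → x ∈ Ioc (0:ℝ) 1 → HasDerivAt (f t) (fx t x) x)
    (hftx : ∀ t x, 0 ≤ t → x ∈ Ioc (0:ℝ) 1 → HasDerivAt (ft t) (ftx t x) x)
    (hftc : ∀ x ∈ Ioc (0:ℝ) 1, ContinuousOn (fun t => ft t x) (Ici 0))
    (hc : ContinuousOn (Function.uncurry ftx) (Ici 0 ×ˢ Ioc (0:ℝ) 1))
    {t x : ℝ} (ht : 0 < t) (hx : x ∈ Ioc (0:ℝ) 1) :
    HasDerivAt (fun r => fx r x) (ftx t x) t := by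
  obtain ⟨s, hs0, hst⟩ := exists_between ht
  obtain ⟨c, hc0, hcx⟩ := exists_between hx.1
  set T := t + 1 with hT
  have htT : t < T := by linarith
  have hc1 : c < 1 := hcx.trans_le hx.2
  have hsub : ∀ ξ ∈ Icc c 1, ξ ∈ Ioc (0:ℝ) 1 := fun ξ h => ⟨hc0.trans_le h.1, h.2⟩
  have hsub' : ∀ ξ ∈ Icc c 1, ξ ∈ Icc (0:ℝ) 1 := fun ξ h => Ioc_subset_Icc_self (hsub ξ h)
  obtain ⟨G, hG, hGe⟩ := exists_continuous_extension_rect (hst.trans htT).le hc1.le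
    (hc.mono (prod_mono (fun r hr => hs0.le.trans hr.1) hsub))
  have hGx : ∀ r, Continuous (G r) := fun r => hG.comp (Continuous.prodMk_right r)
  have hGt : ∀ ξ, Continuous (fun r => G r ξ) := fun ξ => hG.comp (Continuous.prodMk_left ξ)
  have key : ∀ r ∈ Icc s T, fx r x = fx s x + ∫ q in s..r, G q x := by
    intro r hr
    have hI : Continuous fun ξ => ∫ q in s..r, G q ξ := by
      have hG' : Continuous (Function.uncurry fun ξ q => G q ξ) := hG.comp continuous_swap
      exact intervalIntegral.continuous_parametric_intervalIntegral_of_continuous' hG' s r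
    have hid : ∀ ξ ∈ Icc c 1, f r ξ - f s ξ - (f r c - f s c) =
        ∫ ζ in c..ξ, ∫ q in s..r, G q ζ := by
      intro ξ hξ
      have hcm : c ∈ Icc c 1 := left_mem_Icc.2 hc1.le
      have hint : ∀ ζ ∈ Icc c 1, IntervalIntegrable (fun q => ft q ζ) volume s r := by
        intro ζ hζ
        refine ((hftc ζ (hsub ζ hζ)).mono ?_).intervalIntegrable
        rw [uIcc_of_le hr.1]
        exact fun q hq => hs0.le.trans hq.1
      have hq : ∀ ζ ∈ Icc c 1, ∫ q in s..r, ft q ζ = f r ζ - f s ζ := by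
        intro ζ hζ
        refine intervalIntegral.integral_eq_sub_of_hasDerivAt (f := fun r => f r ζ)
          (fun q hq => ?_) (hint ζ hζ)
        rw [uIcc_of_le hr.1] at hq
        exact hft q ζ (hs0.le.trans hq.1) (hsub' ζ hζ)
      rw [← intervalIntegral_swap_of_continuous hG, ← hq ξ hξ, ← hq c hcm,
        ← intervalIntegral.integral_sub (hint ξ hξ) (hint c hcm)]
      refine intervalIntegral_congr_Icc hr.1 fun q hq => ?_
      refine (intervalIntegral.integral_eq_sub_of_hasDerivAt (f := ft q)
        (fun ζ hζ => ?_) ((hGx q).intervalIntegrable _ _)).symm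
      rw [uIcc_of_le hξ.1] at hζ
      have hζ' : ζ ∈ Icc c 1 := ⟨hζ.1, hζ.2.trans hξ.2⟩
      rw [hGe q ⟨hq.1, hq.2.trans hr.2⟩ ζ hζ']
      exact hftx q ζ (hs0.le.trans hq.1) (hsub ζ hζ')
    have hxm : x ∈ Icc c 1 := ⟨hcx.le, hx.2⟩
    have hd1 : HasDerivWithinAt (fun ξ => f r ξ - f s ξ - (f r c - f s c))
        (fx r x - fx s x) (Icc c 1) x :=
      (((hfx r x (hs0.le.trans hr.1) hx).sub (hfx s x hs0.le hx)).sub_const _).hasDerivWithinAt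
    have hd2 : HasDerivWithinAt (fun ξ => f r ξ - f s ξ - (f r c - f s c))
        (∫ q in s..r, G q x) (Icc c 1) x :=
      (intervalIntegral.integral_hasDerivAt_right (hI.intervalIntegrable c x)
        hI.stronglyMeasurable.stronglyMeasurableAtFilter hI.continuousAt).hasDerivWithinAt.congr
        hid (hid x hxm)
    have := ((uniqueDiffOn_Icc hc1) x hxm).eq_deriv _ hd1 hd2
    linarith
  have hd : HasDerivAt (fun r => fx s x + ∫ q in s..r, G q x) (G t x) t :=
    (intervalIntegral.integral_hasDerivAt_right ((hGt x).intervalIntegrable s t)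
      (hGt x).stronglyMeasurable.stronglyMeasurableAtFilter (hGt x).continuousAt).const_add _
  rw [hGe t ⟨hst.le, htT.le⟩ x ⟨hcx.le, hx.2⟩] at hd
  exact hd.congr_of_eventuallyEq
    (Filter.eventually_of_mem (Icc_mem_nhds hst htT) key)

lemma sq_setIntegral_le {f : ℝ → ℝ} {ε : ℝ} (hε : 0 < ε)
    (hm : AEStronglyMeasurable f (volume.restrict (Ioo 0 ε)))
    (hf : IntegrableOn (fun x => f x ^ 2) (Ioo 0 ε)) :
    (∫ x in Ioo 0 ε, f x) ^ 2 ≤ ε * ∫ x in Ioo 0 ε, f x ^ 2 := by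
  have hone : IntegrableOn (fun _ : ℝ => (1:ℝ)) (Ioo 0 ε) := by simp
  have hfi : IntegrableOn f (Ioo 0 ε) := by
    refine Integrable.mono' (hone.add hf) hm (Eventually.of_forall fun x => ?_)
    simp only [Pi.add_apply, Real.norm_eq_abs]
    nlinarith [sq_abs (f x), sq_nonneg (|f x| - 1)]
  set I := ∫ x in Ioo 0 ε, f x with hI
  have h0 : 0 ≤ ∫ x in Ioo 0 ε, (f x - I / ε) ^ 2 := integral_nonneg fun x => sq_nonneg _
  have h1 : ∫ x in Ioo 0 ε, (f x - I / ε) ^ 2 =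
      (∫ x in Ioo 0 ε, f x ^ 2) - 2 * (I / ε) * I + (I / ε) ^ 2 * ε := by
    have : ∀ x, (f x - I / ε) ^ 2 = f x ^ 2 - 2 * (I / ε) * f x + (I / ε) ^ 2 * 1 := by
      intro x; ring
    simp_rw [this]
    have hsub : IntegrableOn (fun x => f x ^ 2 - 2 * (I / ε) * f x) (Ioo 0 ε) :=
      hf.sub (hfi.const_mul _)
    rw [integral_add hsub (hone.const_mul _), integral_sub hf (hfi.const_mul _), integral_const_mul, integral_const_mul]
    simp [hε.le, ← hI]
  have h2 : (∫ x in Ioo 0 ε, f x ^ 2) - 2 * (I / ε) * I + (I / ε) ^ 2 * ε =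
      (∫ x in Ioo 0 ε, f x ^ 2) - I ^ 2 / ε := by
    field_simp; ring
  rw [h1, h2, sub_nonneg, div_le_iff₀ hε] at h0
  linarith

lemma exists_mul_lt_of_integrableOn {f : ℝ → ℝ} {δ r : ℝ} (hf : IntegrableOn f (Ioo 0 1))
    (hδ : 0 < δ) (hr : 0 < r) (hr1 : r ≤ 1) : ∃ x ∈ Ioo 0 r, x * f x < δ := by
  by_contra! h
  have h1 : IntegrableOn (fun x : ℝ => δ * x⁻¹) (Ioo 0 r) := by
    refine Integrable.mono' (hf.mono_set (Ioo_subset_Ioo_right hr1))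
      (by fun_prop) ((ae_restrict_iff' measurableSet_Ioo).2 (Eventually.of_forall fun x hx => ?_))
    have hx0 : 0 < x := hx.1
    rw [Real.norm_of_nonneg (by positivity), ← div_eq_mul_inv, div_le_iff₀ hx0]
    linarith [h x hx]
  have h2 : IntervalIntegrable (fun x : ℝ => x⁻¹) volume 0 r := by
    rw [intervalIntegrable_iff_integrableOn_Ioo_of_le hr.le]
    have := h1.const_mul δ⁻¹
    simpa [IntegrableOn, hδ.ne', ← mul_assoc] using this
  rw [intervalIntegrable_inv_iff] at h2
  rcases h2 with h2 | h2
  · exact hr.ne h2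
  · exact h2 left_mem_uIcc

lemma tendsto_setIntegral_Ioo_zero {f : ℝ → ℝ} (hf : IntegrableOn f (Ioo 0 1)) :
    Tendsto (fun ε => ∫ x in Ioo 0 ε, f x) (𝓝[>] 0) (𝓝 0) := by
  have hf' : IntervalIntegrable f volume 0 1 :=
    (intervalIntegrable_iff_integrableOn_Ioo_of_le zero_le_one).2 hf
  have hc := intervalIntegral.continuousOn_primitive_interval' hf' left_mem_uIcc 0 left_mem_uIcc
  rw [uIcc_of_le zero_le_one] at hc
  have hc' : Tendsto (fun ε => ∫ x in (0:ℝ)..ε, f x) (𝓝[>] 0) (𝓝 0) := by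
    have := hc.tendsto
    rw [intervalIntegral.integral_same] at this
    refine this.mono_left ?_
    rw [← nhdsWithin_Ioc_eq_nhdsGT zero_lt_one]
    exact nhdsWithin_mono _ Ioc_subset_Icc_self
  refine hc'.congr' ?_
  filter_upwards [self_mem_nhdsWithin] with ε hε
  rw [intervalIntegral.integral_of_le (le_of_lt hε), integral_Ioc_eq_integral_Ioo]

lemma etaW_pos (a b : ℝ → ℝ) (x : ℝ) : 0 < etaW a b x := Real.exp_pos _

/-- The consequences of `HypH2` on the coefficients which enter the multiplier estimate. -/
structure CoeffBounds (a a' b : ℝ → ℝ) (K ε₀ : ℝ) : Prop where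
  K_pos : 0 < K
  K_lt : K < 2
  a_cont : ContinuousOn a (Icc 0 1)
  a_pos : ∀ x ∈ Ioc (0:ℝ) 1, 0 < a x
  a_deriv : ∀ x ∈ Ioo (0:ℝ) 1, HasDerivAt a (a' x) x
  a'_le : ∀ x ∈ Ioc (0:ℝ) 1, x * |a' x| ≤ K * a x
  b_cont : ContinuousOn b (Icc 0 1)
  ba_int : IntegrableOn (fun x => b x / a x) (Ioo (0:ℝ) 1)
  eps_pos : 0 < ε₀
  eps_le : ∀ x ∈ Icc (0:ℝ) 1, ε₀ * a x ≤ (2 - K) * a x - 2 * x * |b x|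

lemma HypH2.coeffBounds {a a' b : ℝ → ℝ} {K ε₀ : ℝ} (h : HypH2 a a' b K ε₀) :
    CoeffBounds a a' b K ε₀ := by
  obtain ⟨⟨hd, hb, hba, -⟩, hε, hle⟩ := h
  have hlub : ∀ x ∈ Ioc (0:ℝ) 1, 0 < a x →
      IsLUB ((fun x => x * |a' x| / a x) '' Ioc (0:ℝ) 1) K → x * |a' x| ≤ K * a x := by
    intro x hx hax hl
    have := hl.1 (mem_image_of_mem _ hx)
    rwa [div_le_iff₀ hax] at this
  rcases hd with ⟨h1, -, h3, h4, -, h6, h7, h8⟩ | ⟨h1, -, h3, h4, -, h6, h7, h8⟩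
  · exact ⟨h7, by linarith, h1, h3, fun x hx => h4 x (Ioo_subset_Ioc_self hx),
      fun x hx => hlub x hx (h3 x hx) h6, hb, hba, hε, hle⟩
  · exact ⟨by linarith, h8, h1, h3, fun x hx => (h4 x (Ioo_subset_Icc_self hx)).hasDerivAt
      (Icc_mem_nhds hx.1 hx.2), fun x hx => hlub x hx (h3 x hx) h6, hb, hba, hε, hle⟩

namespace CoeffBounds

variable {a a' b : ℝ → ℝ} {K ε₀ : ℝ}

lemma etaW_cont (h : CoeffBounds a a' b K ε₀) : ContinuousOn (etaW a b) (Icc 0 1) := by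
  have hf' : IntervalIntegrable (fun x => b x / a x) volume 0 1 :=
    (intervalIntegrable_iff_integrableOn_Ioo_of_le zero_le_one).2 h.ba_int
  have hm : (1 / 2 : ℝ) ∈ uIcc (0:ℝ) 1 := by
    rw [uIcc_of_le zero_le_one]; constructor <;> norm_num
  have := intervalIntegral.continuousOn_primitive_interval' hf' hm
  rw [uIcc_of_le zero_le_one] at this
  exact Real.continuous_exp.comp_continuousOn this

lemma etaW_deriv (h : CoeffBounds a a' b K ε₀) {x : ℝ} (hx : x ∈ Ioo (0:ℝ) 1) :
    HasDerivAt (etaW a b) (etaW a b x * (b x / a x)) x := by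
  have hc : ContinuousOn (fun x => b x / a x) (Ioo 0 1) :=
    (h.b_cont.mono Ioo_subset_Icc_self).div (h.a_cont.mono Ioo_subset_Icc_self)
      fun x hx => (h.a_pos x (Ioo_subset_Ioc_self hx)).ne'
  have hf' : IntervalIntegrable (fun x => b x / a x) volume (1 / 2) x := by
    refine ((intervalIntegrable_iff_integrableOn_Ioo_of_le zero_le_one).2 h.ba_int).mono_set ?_
    rw [uIcc_of_le zero_le_one]
    exact uIcc_subset_Icc (by constructor <;> norm_num) (Ioo_subset_Icc_self hx)
  exact (intervalIntegral.integral_hasDerivAt_right hf'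
    (hc.stronglyMeasurableAtFilter isOpen_Ioo x hx) (hc.continuousAt (Ioo_mem_nhds hx.1 hx.2))).exp

lemma sigW_pos (h : CoeffBounds a a' b K ε₀) {x : ℝ} (hx : x ∈ Ioc (0:ℝ) 1) :
    0 < sigW a b x := div_pos (h.a_pos x hx) (etaW_pos a b x)

lemma sigW_cont (h : CoeffBounds a a' b K ε₀) : ContinuousOn (sigW a b) (Icc 0 1) :=
  h.a_cont.div h.etaW_cont fun x _ => (etaW_pos a b x).ne'

lemma sq_div_le (h : CoeffBounds a a' b K ε₀) {x : ℝ} (hx : x ∈ Ioc (0:ℝ) 1) :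
    x ^ 2 / a x ≤ 1 / a 1 := by
  have hsub : ∀ z ∈ Icc x 1, z ∈ Ioc (0:ℝ) 1 := fun z hz => ⟨hx.1.trans_le hz.1, hz.2⟩
  have hd : ∀ z ∈ Ioo x 1, HasDerivAt (fun z => z ^ 2 / a z)
      ((2 * z * a z - z ^ 2 * a' z) / a z ^ 2) z := by
    intro z hz
    have hz1 := hsub z (Ioo_subset_Icc_self hz)
    exact ((hasDerivAt_pow 2 z).fun_div (h.a_deriv z ⟨hz1.1, hz.2⟩)
      (h.a_pos z hz1).ne').congr_deriv (by norm_num)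
  have hm : MonotoneOn (fun z => z ^ 2 / a z) (Icc x 1) := by
    refine monotoneOn_of_deriv_nonneg (convex_Icc x 1) ?_ ?_ ?_
    · exact ContinuousOn.div (by fun_prop)
        (h.a_cont.mono fun z hz => Ioc_subset_Icc_self (hsub z hz))
        fun z hz => (h.a_pos z (hsub z hz)).ne'
    · rw [interior_Icc]
      exact fun z hz => (hd z hz).differentiableAt.differentiableWithinAt
    · rw [interior_Icc]
      intro z hz
      have hz1 := hsub z (Ioo_subset_Icc_self hz)
      rw [(hd z hz).deriv]
      refine div_nonneg ?_ (sq_nonneg _)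
      have h1 : z * a' z ≤ K * a z :=
        (mul_le_mul_of_nonneg_left (le_abs_self _) hz1.1.le).trans (h.a'_le z hz1)
      have h2 : K * a z ≤ 2 * a z := mul_le_mul_of_nonneg_right h.K_lt.le (h.a_pos z hz1).le
      have := mul_nonneg hz1.1.le (sub_nonneg.2 (h1.trans h2))
      linarith
  simpa using hm (left_mem_Icc.2 hx.2) (right_mem_Icc.2 hx.2) hx.2

lemma etaW_bounds (h : CoeffBounds a a' b K ε₀) :
    0 < sInf (etaW a b '' Icc 0 1) ∧ (∀ x ∈ Icc (0:ℝ) 1, sInf (etaW a b '' Icc 0 1) ≤ etaW a b x) ∧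
      ∃ M, ∀ x ∈ Icc (0:ℝ) 1, etaW a b x ≤ M := by
  have hcomp : IsCompact (etaW a b '' Icc 0 1) := isCompact_Icc.image_of_continuousOn h.etaW_cont
  refine ⟨?_, fun x hx => csInf_le hcomp.bddBelow (mem_image_of_mem _ hx), ?_⟩
  · obtain ⟨z, -, hz⟩ := hcomp.sInf_mem ((nonempty_Icc.2 zero_le_one).image _)
    rw [← hz]
    exact etaW_pos a b z
  · obtain ⟨M, hM⟩ := hcomp.bddAbove
    exact ⟨M, fun x hx => hM (mem_image_of_mem _ hx)⟩

end CoeffBounds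

lemma MemH1sig0.sq_le {a b v v' : ℝ → ℝ} (h : MemH1sig0 a b v v')
    (hc : ContinuousOn v' (Ioc 0 1)) {ε : ℝ} (hε : ε ∈ Ioc (0:ℝ) 1) :
    v ε ^ 2 ≤ ε * ∫ x in Ioo 0 ε, v' x ^ 2 := by
  have hsub : Ioo 0 ε ⊆ Ioc (0:ℝ) 1 := fun x hx => ⟨hx.1, hx.2.le.trans hε.2⟩
  rw [h.ftc ε (Ioc_subset_Icc_self hε), h.zero, zero_add]
  exact sq_setIntegral_le hε.1 ((hc.mono hsub).aestronglyMeasurable measurableSet_Ioo)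
    (h.deriv_sq_int.mono_set (Ioo_subset_Ioo_right hε.2))

namespace ClassicalSol

variable {a a' b : ℝ → ℝ} {K ε₀ β : ℝ} {y yt yx ytt ytx yxx : ℝ → ℝ → ℝ}

lemma yx_cont_x (hy : ClassicalSol a b β y yt yx ytt ytx yxx) {t : ℝ} (ht : 0 ≤ t) :
    ContinuousOn (yx t) (Ioc 0 1) :=
  fun x hx => (hy.dxx t x ht hx).continuousAt.continuousWithinAt

lemma yt_cont_x (hy : ClassicalSol a b β y yt yx ytt ytx yxx) {t : ℝ} (ht : 0 ≤ t) :
    ContinuousOn (yt t) (Ioc 0 1) :=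
  fun x hx => (hy.dtx t x ht hx).continuousAt.continuousWithinAt

lemma y_cont_x (hy : ClassicalSol a b β y yt yx ytt ytx yxx) {t : ℝ} (ht : 0 ≤ t) :
    ContinuousOn (y t) (Ioc 0 1) :=
  fun x hx => (hy.dx t x ht hx).continuousAt.continuousWithinAt

lemma ytx_cont_x (hy : ClassicalSol a b β y yt yx ytt ytx yxx) {t : ℝ} (ht : 0 ≤ t) :
    ContinuousOn (ytx t) (Ioc 0 1) :=
  hy.cont_tx.comp (f := fun x => (t, x)) (by fun_prop) fun _ hx => ⟨ht, hx⟩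

lemma ytt_cont_x (hy : ClassicalSol a b β y yt yx ytt ytx yxx) {t : ℝ} (ht : 0 ≤ t) :
    ContinuousOn (ytt t) (Ioc 0 1) :=
  hy.cont_tt.comp (f := fun x => (t, x)) (by fun_prop) fun _ hx => ⟨ht, hx⟩

lemma yx_deriv_t (hy : ClassicalSol a b β y yt yx ytt ytx yxx) {t x : ℝ} (ht : 0 < t)
    (hx : x ∈ Ioc (0:ℝ) 1) : HasDerivAt (fun r => yx r x) (ytx t x) t :=
  hasDerivAt_mixed hy.dt hy.dx hy.dtx
    (fun z hz r hr => (hy.dtt r z hr (Ioc_subset_Icc_self hz)).continuousAt.continuousWithinAt)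
    hy.cont_tx ht hx

section rect

variable {s T c : ℝ}

lemma rect_subset (hs : 0 < s) (hc : 0 < c) :
    Icc s T ×ˢ Icc c 1 ⊆ Ici (0:ℝ) ×ˢ Ioc (0:ℝ) 1 :=
  prod_mono (fun _ h => hs.le.trans h.1) fun _ h => ⟨hc.trans_le h.1, h.2⟩

lemma yt_cont (hy : ClassicalSol a b β y yt yx ytt ytx yxx) (hs : 0 < s) (hc : 0 < c) :
    ContinuousOn (Function.uncurry yt) (Icc s T ×ˢ Icc c 1) :=
  continuousOn_rect_of_hasDerivAt
    (fun t ht x hx => hy.dtt t x (hs.le.trans ht.1) ⟨hc.le.trans hx.1, hx.2⟩)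
    (fun _ ht => (hy.yt_cont_x (hs.le.trans ht.1)).mono fun _ hx => ⟨hc.trans_le hx.1, hx.2⟩)
    (hy.cont_tt.mono (rect_subset hs hc))

lemma y_cont (hy : ClassicalSol a b β y yt yx ytt ytx yxx) (hs : 0 < s) (hc : 0 < c) :
    ContinuousOn (Function.uncurry y) (Icc s T ×ˢ Icc c 1) :=
  continuousOn_rect_of_hasDerivAt
    (fun t ht x hx => hy.dt t x (hs.le.trans ht.1) ⟨hc.le.trans hx.1, hx.2⟩)
    (fun _ ht => (hy.y_cont_x (hs.le.trans ht.1)).mono fun _ hx => ⟨hc.trans_le hx.1, hx.2⟩)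
    (hy.yt_cont hs hc)

lemma yx_cont (hy : ClassicalSol a b β y yt yx ytt ytx yxx) (hs : 0 < s) (hc : 0 < c) :
    ContinuousOn (Function.uncurry yx) (Icc s T ×ˢ Icc c 1) :=
  continuousOn_rect_of_hasDerivAt
    (fun _ ht _ hx => hy.yx_deriv_t (hs.trans_le ht.1) ⟨hc.trans_le hx.1, hx.2⟩)
    (fun _ ht => (hy.yx_cont_x (hs.le.trans ht.1)).mono fun _ hx => ⟨hc.trans_le hx.1, hx.2⟩)
    (hy.cont_tx.mono (rect_subset hs hc))

end rect

/-- The wave equation in divergence form, `(η yₓ)ₓ = yₜₜ / σ`. -/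
lemma flux_deriv (hy : ClassicalSol a b β y yt yx ytt ytx yxx) (h : CoeffBounds a a' b K ε₀)
    {t x : ℝ} (ht : 0 < t) (hx : x ∈ Ioo (0:ℝ) 1) :
    HasDerivAt (fun z => etaW a b z * yx t z) (ytt t x / sigW a b x) x := by
  have hx' := Ioo_subset_Ioc_self hx
  have ha := (h.a_pos x hx').ne'
  have hη := (etaW_pos a b x).ne'
  refine ((h.etaW_deriv hx).mul (hy.dxx t x ht.le hx')).congr_deriv ?_
  rw [hy.pde t x ht hx, sigW]
  field_simp
  ring

lemma integrableOn_yt (hy : ClassicalSol a b β y yt yx ytt ytx yxx) {t : ℝ} (ht : 0 ≤ t) :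
    IntegrableOn (fun x => yt t x ^ 2 / sigW a b x) (Ioo (0:ℝ) 1) :=
  (hy.regt t ht).l2sig.2

lemma integrableOn_yx (hy : ClassicalSol a b β y yt yx ytt ytx yxx)
    (h : CoeffBounds a a' b K ε₀) {t : ℝ} (ht : 0 ≤ t) :
    IntegrableOn (fun x => etaW a b x * yx t x ^ 2) (Ioo (0:ℝ) 1) := by
  obtain ⟨-, -, M, hM⟩ := h.etaW_bounds
  refine Integrable.mono' ((hy.regx t ht).deriv_sq_int.const_mul M) ?_ ?_
  · exact ((h.etaW_cont.mono Ioo_subset_Icc_self).mul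
      (((hy.yx_cont_x ht).mono Ioo_subset_Ioc_self).pow 2)).aestronglyMeasurable measurableSet_Ioo
  · refine (ae_restrict_iff' measurableSet_Ioo).2 (Eventually.of_forall fun x hx => ?_)
    rw [Real.norm_of_nonneg (mul_nonneg (etaW_pos a b x).le (sq_nonneg _))]
    exact mul_le_mul_of_nonneg_right (hM x (Ioo_subset_Icc_self hx)) (sq_nonneg _)

lemma memH1sig0_y (hy : ClassicalSol a b β y yt yx ytt ytx yxx) {t : ℝ} (ht : 0 ≤ t) :
    MemH1sig0 a b (y t) (yx t) :=
  ⟨(hy.regx t ht).toMemH1sig, (hy.regx t ht).zero⟩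

lemma integrableOn_powerDensity (hy : ClassicalSol a b β y yt yx ytt ytx yxx)
    (h : CoeffBounds a a' b K ε₀) {t : ℝ} (ht : 0 < t) :
    IntegrableOn (fun x => 2 * yt t x * ytt t x / sigW a b x +
      2 * etaW a b x * yx t x * ytx t x) (Ioo (0:ℝ) 1) := by
  obtain ⟨-, -, M, hM⟩ := h.etaW_bounds
  have hyt := (hy.yt_cont_x ht.le).mono Ioo_subset_Ioc_self
  have hyx := (hy.yx_cont_x ht.le).mono Ioo_subset_Ioc_self
  have hytt := (hy.ytt_cont_x ht.le).mono Ioo_subset_Ioc_self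
  have hytx := (hy.ytx_cont_x ht.le).mono Ioo_subset_Ioc_self
  have hη := h.etaW_cont.mono Ioo_subset_Icc_self
  have hσ := h.sigW_cont.mono Ioo_subset_Icc_self
  have hσp : ∀ x ∈ Ioo (0:ℝ) 1, 0 < sigW a b x := fun x hx => h.sigW_pos (Ioo_subset_Ioc_self hx)
  have htt : IntegrableOn (fun x => ytt t x ^ 2 / sigW a b x) (Ioo (0:ℝ) 1) := by
    refine (hy.regx t ht.le).Au_l2sig.2.congr_fun (fun x hx => ?_) measurableSet_Ioo
    have ha := (h.a_pos x (Ioo_subset_Ioc_self hx)).ne'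
    have hη := (etaW_pos a b x).ne'
    have : sigW a b x * (etaW a b x * (b x / a x * yx t x + yxx t x)) = ytt t x := by
      rw [hy.pde t x ht hx, sigW]
      field_simp
      ring
    simp only [this]
  refine Integrable.add ?_ ?_
  · refine Integrable.mono' ((hy.integrableOn_yt ht.le).add htt) ?_ ?_
    · exact (((continuousOn_const.mul hyt).mul hytt).div hσ
        fun x hx => (hσp x hx).ne').aestronglyMeasurable measurableSet_Ioo
    · refine (ae_restrict_iff' measurableSet_Ioo).2 (Eventually.of_forall fun x hx => ?_)
      have hs := hσp x hx
      simp only [Pi.add_apply, Real.norm_eq_abs]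
      rw [abs_div, abs_of_pos hs, ← add_div]
      gcongr
      rw [abs_le]
      constructor <;> nlinarith [sq_nonneg (yt t x + ytt t x), sq_nonneg (yt t x - ytt t x)]
  · refine Integrable.mono' (((hy.regx t ht.le).deriv_sq_int.add
      (hy.regt t ht.le).deriv_sq_int).const_mul M) ?_ ?_
    · exact (((continuousOn_const.mul hη).mul hyx).mul hytx).aestronglyMeasurable
        measurableSet_Ioo
    · refine (ae_restrict_iff' measurableSet_Ioo).2 (Eventually.of_forall fun x hx => ?_)
      have hηp := etaW_pos a b x
      have hηM := hM x (Ioo_subset_Icc_self hx)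
      have h2 : |2 * yx t x * ytx t x| ≤ yx t x ^ 2 + ytx t x ^ 2 := by
        rw [abs_le]
        constructor <;> nlinarith [sq_nonneg (yx t x + ytx t x), sq_nonneg (yx t x - ytx t x)]
      calc ‖2 * etaW a b x * yx t x * ytx t x‖ = etaW a b x * |2 * yx t x * ytx t x| := by
            rw [Real.norm_eq_abs, ← abs_of_pos hηp, ← abs_mul, abs_of_pos hηp]
            congr 1; ring
        _ ≤ M * (yx t x ^ 2 + ytx t x ^ 2) :=
            mul_le_mul hηM h2 (abs_nonneg _) (hηp.le.trans hηM)

lemma integral_powerDensity (hy : ClassicalSol a b β y yt yx ytt ytx yxx)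
    (h : CoeffBounds a a' b K ε₀) {t : ℝ} (ht : 0 < t) :
    ∫ x in Ioo (0:ℝ) 1, (2 * yt t x * ytt t x / sigW a b x +
      2 * etaW a b x * yx t x * ytx t x) = 2 * etaW a b 1 * yx t 1 * yt t 1 := by
  have hφ := hy.integrableOn_powerDensity h ht
  set φ := fun x => 2 * yt t x * ytt t x / sigW a b x + 2 * etaW a b x * yx t x * ytx t x with hφd
  obtain ⟨-, -, M, hM⟩ := h.etaW_bounds
  have hM0 : 0 ≤ M := (etaW_pos a b 0).le.trans (hM 0 (left_mem_Icc.2 zero_le_one))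
  have hd : ∀ x ∈ Ioo (0:ℝ) 1, HasDerivAt (fun x => 2 * (etaW a b x * yx t x) * yt t x)
      (φ x) x := by
    intro x hx
    refine (((hy.flux_deriv h ht hx).const_mul 2).mul
      (hy.dtx t x ht.le (Ioo_subset_Ioc_self hx))).congr_deriv ?_
    simp only [hφd]
    ring
  have hcont : ContinuousOn (fun x => 2 * (etaW a b x * yx t x) * yt t x) (Ioc 0 1) :=
    (continuousOn_const.mul ((h.etaW_cont.mono Ioc_subset_Icc_self).mul
      (hy.yx_cont_x ht.le))).mul (hy.yt_cont_x ht.le)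
  refine eq_of_forall_dist_le fun δ' hδ' => ?_
  set δ := δ' / (1 + 2 * M) with hδ
  have hδ0 : 0 < δ := by positivity
  have hδe : δ * (1 + 2 * M) = δ' := div_mul_cancel₀ _ (by positivity)
  have hev1 := (tendsto_setIntegral_Ioo_zero hφ).abs.eventually_lt_const
    (show |(0:ℝ)| < δ by simpa using hδ0)
  have hev2 := (tendsto_setIntegral_Ioo_zero
    (hy.regt t ht.le).deriv_sq_int).eventually_lt_const hδ0
  obtain ⟨r, hr0, hr⟩ := (nhdsGT_basis (0:ℝ)).eventually_iff.1 (hev1.and hev2)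
  obtain ⟨ε, hε, hlt⟩ := exists_mul_lt_of_integrableOn (hy.regx t ht.le).deriv_sq_int hδ0
    (lt_min hr0 one_pos) (min_le_right _ _)
  have hε0 : 0 < ε := hε.1
  have hε1 : ε < 1 := hε.2.trans_le (min_le_right _ _)
  obtain ⟨h1, h2⟩ := hr ⟨hε.1, hε.2.trans_le (min_le_left _ _)⟩
  have hφi : IntervalIntegrable φ volume 0 1 :=
    (intervalIntegrable_iff_integrableOn_Ioo_of_le zero_le_one).2 hφ
  have hφ0 : IntervalIntegrable φ volume 0 ε :=
    hφi.mono_set (by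
      rw [uIcc_of_le zero_le_one, uIcc_of_le hε0.le]; exact Icc_subset_Icc_right hε1.le)
  have hφ1 : IntervalIntegrable φ volume ε 1 :=
    hφi.mono_set (by
      rw [uIcc_of_le zero_le_one, uIcc_of_le hε1.le]; exact Icc_subset_Icc_left hε0.le)
  have hftc := intervalIntegral.integral_eq_sub_of_hasDerivAt_of_le hε1.le
    (hcont.mono fun x hx => ⟨hε0.trans_le hx.1, hx.2⟩)
    (fun x hx => hd x ⟨hε0.trans hx.1, hx.2⟩) hφ1
  have hsplit := intervalIntegral.integral_add_adjacent_intervals hφ0 hφ1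
  rw [intervalIntegral.integral_of_le hε0.le, integral_Ioc_eq_integral_Ioo,
    intervalIntegral.integral_of_le zero_le_one, integral_Ioc_eq_integral_Ioo, hftc] at hsplit
  have hεm : ε ∈ Ioc (0:ℝ) 1 := ⟨hε0, hε1.le⟩
  have hsq := (hy.regt t ht.le).sq_le (hy.ytx_cont_x ht.le) hεm
  have hbd : |2 * (etaW a b ε * yx t ε) * yt t ε| ≤ M * (2 * δ) := by
    have hprod : |2 * yx t ε * yt t ε| ≤ 2 * δ := by
      have h3 : yt t ε ^ 2 ≤ ε * δ := hsq.trans (by gcongr)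
      have h4 : ε * (2 * |yx t ε| * |yt t ε|) ≤ ε * (2 * δ) := by
        have := sq_nonneg (ε * |yx t ε| - |yt t ε|)
        have e1 : (ε * |yx t ε| - |yt t ε|) ^ 2 =
          ε * (ε * yx t ε ^ 2) - ε * (2 * |yx t ε| * |yt t ε|) + yt t ε ^ 2 := by
          rw [← sq_abs (yx t ε), ← sq_abs (yt t ε)]; ring
        have h5 : ε * (ε * yx t ε ^ 2) ≤ ε * δ := by gcongr
        linarith
      have := le_of_mul_le_mul_left h4 hε0
      rwa [abs_mul, abs_mul, abs_two]
    have hηp := etaW_pos a b ε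
    calc |2 * (etaW a b ε * yx t ε) * yt t ε| = etaW a b ε * |2 * yx t ε * yt t ε| := by
          rw [← abs_of_pos hηp, ← abs_mul, abs_of_pos hηp]
          congr 1; ring
      _ ≤ M * (2 * δ) := mul_le_mul (hM ε (Ioc_subset_Icc_self hεm)) hprod (abs_nonneg _) hM0
  rw [Real.dist_eq, ← hsplit, ← hδe]
  rw [abs_le] at hbd ⊢
  rw [abs_lt] at h1
  constructor <;> nlinarith [hbd.1, hbd.2, h1.1, h1.2]

lemma hasDerivAt_energy (hy : ClassicalSol a b β y yt yx ytt ytx yxx)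
    (h : CoeffBounds a a' b K ε₀) {t : ℝ} (ht : 0 < t) :
    HasDerivAt (energy a b β y yt yx) (-(yt t 1) ^ 2) t := by
  have hd := hy.ediff t ht.le
  rw [hy.integral_powerDensity h ht] at hd
  have h1 := hy.dt t 1 ht.le (right_mem_Icc.2 zero_le_one)
  refine ((hd.add ((h1.fun_pow 2).const_mul β)).const_mul (1 / 2)).congr_deriv ?_
  have := hy.bc1 t ht
  have e : etaW a b 1 * yx t 1 = -yt t 1 - β * y t 1 := by linarith
  rw [mul_assoc 2, e]
  norm_num
  ring

lemma integral_boundary_velocity (hy : ClassicalSol a b β y yt yx ytt ytx yxx)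
    (h : CoeffBounds a a' b K ε₀) {s T : ℝ} (hs : 0 < s) (hsT : s < T) :
    ∫ t in s..T, yt t 1 ^ 2 = energy a b β y yt yx s - energy a b β y yt yx T := by
  have hi : IntervalIntegrable (fun t => yt t 1 ^ 2) volume s T :=
    (intervalIntegrable_iff_integrableOn_Ioo_of_le hsT.le).2 (hy.intBdry s T hs hsT).1
  have := intervalIntegral.integral_eq_sub_of_hasDerivAt (f := energy a b β y yt yx)
    (f' := fun t => -(yt t 1) ^ 2) (a := s) (b := T) (fun t ht => ?_) hi.neg
  · rw [intervalIntegral.integral_neg] at this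
    linarith
  · rw [uIcc_of_le hsT.le] at ht
    exact hy.hasDerivAt_energy h (hs.trans_le ht.1)

/-- The density integrated in space by the multipliers `2 x yₓ` and `-(K / 2) y`. -/
noncomputable def multiplierDensity (a b : ℝ → ℝ) (K : ℝ) (y yt yx : ℝ → ℝ → ℝ) (t x : ℝ) : ℝ :=
  2 * x * yt t x * yx t x / sigW a b x - K / 2 * (y t x * yt t x) / sigW a b x

/-- The flux through `x` produced by the multipliers `2 x yₓ` and `-(K / 2) y`. -/
noncomputable def multiplierFlux (a b : ℝ → ℝ) (K : ℝ) (y yt yx : ℝ → ℝ → ℝ) (t x : ℝ) : ℝ :=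
  x * (etaW a b x * yx t x * yx t x) + x * (yt t x ^ 2 / sigW a b x) -
    K / 2 * (y t x * (etaW a b x * yx t x))

/-- Twice the interior energy density. -/
noncomputable def energyDensity (a b : ℝ → ℝ) (yt yx : ℝ → ℝ → ℝ) (t x : ℝ) : ℝ :=
  yt t x ^ 2 / sigW a b x + etaW a b x * yx t x ^ 2

lemma sigW_deriv (h : CoeffBounds a a' b K ε₀) {x : ℝ} (hx : x ∈ Ioo (0:ℝ) 1) :
    HasDerivAt (sigW a b) ((a' x - b x) / etaW a b x) x := by
  have ha := (h.a_pos x (Ioo_subset_Ioc_self hx)).ne'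
  have hη := (etaW_pos a b x).ne'
  refine ((h.a_deriv x hx).div (h.etaW_deriv hx) hη).congr_deriv ?_
  field_simp

lemma multiplierDensity_deriv (hy : ClassicalSol a b β y yt yx ytt ytx yxx) {t x : ℝ}
    (ht : 0 < t) (hx : x ∈ Ioc (0:ℝ) 1) :
    HasDerivAt (fun r => multiplierDensity a b K y yt yx r x)
      (2 * x * (ytt t x * yx t x + yt t x * ytx t x) / sigW a b x -
        K / 2 * (yt t x ^ 2 + y t x * ytt t x) / sigW a b x) t := by
  have h1 := hy.dt t x ht.le (Ioc_subset_Icc_self hx)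
  have h2 := hy.dtt t x ht.le (Ioc_subset_Icc_self hx)
  have h3 := hy.yx_deriv_t ht hx
  refine (((((h2.const_mul (2 * x)).mul h3)).div_const (sigW a b x)).sub
    (((h1.mul h2).const_mul (K / 2)).div_const (sigW a b x))).congr_deriv ?_
  ring

lemma multiplierFlux_deriv (hy : ClassicalSol a b β y yt yx ytt ytx yxx)
    (h : CoeffBounds a a' b K ε₀) {t x : ℝ} (ht : 0 < t) (hx : x ∈ Ioo (0:ℝ) 1) :
    HasDerivAt (multiplierFlux a b K y yt yx t)
      (2 * x * (ytt t x * yx t x + yt t x * ytx t x) / sigW a b x -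
        K / 2 * (yt t x ^ 2 + y t x * ytt t x) / sigW a b x +
        ((1 + K / 2 - x * (a' x - b x) / a x) * (yt t x ^ 2 / sigW a b x) +
          (1 - K / 2 - x * b x / a x) * (etaW a b x * yx t x ^ 2))) x := by
  have hx' := Ioo_subset_Ioc_self hx
  have hax := h.a_pos x hx'
  have ha := hax.ne'
  have hη := (etaW_pos a b x).ne'
  have hp := hy.flux_deriv h ht hx
  have hid := hasDerivAt_id x
  have h1 := hid.mul (hp.mul (hy.dxx t x ht.le hx'))
  have h2 := hid.mul (((hy.dtx t x ht.le hx').fun_pow 2).div (sigW_deriv h hx)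
    (h.sigW_pos hx').ne')
  have h3 := ((hy.dx t x ht.le hx').mul hp).const_mul (K / 2)
  refine ((h1.add h2).sub h3).congr_deriv ?_
  simp only [id, Pi.mul_apply, Pi.div_apply]
  rw [hy.pde t x ht hx, sigW]
  field_simp
  ring

lemma energyDensity_le (h : CoeffBounds a a' b K ε₀) {t x : ℝ} (hx : x ∈ Ioo (0:ℝ) 1) :
    ε₀ / 2 * energyDensity a b yt yx t x ≤
      (1 + K / 2 - x * (a' x - b x) / a x) * (yt t x ^ 2 / sigW a b x) +
        (1 - K / 2 - x * b x / a x) * (etaW a b x * yx t x ^ 2) := by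
  have hx' := Ioo_subset_Ioc_self hx
  have hax := h.a_pos x hx'
  have heps := h.eps_le x (Ioo_subset_Icc_self hx)
  have hb1 : x * b x ≤ x * |b x| := mul_le_mul_of_nonneg_left (le_abs_self _) hx.1.le
  have hb2 : -(x * |b x|) ≤ x * b x := by
    rw [← mul_neg]
    exact mul_le_mul_of_nonneg_left (neg_abs_le _) hx.1.le
  have ha1 : x * a' x ≤ K * a x :=
    (mul_le_mul_of_nonneg_left (le_abs_self _) hx.1.le).trans (h.a'_le x hx')
  have c1 : ε₀ / 2 ≤ 1 + K / 2 - x * (a' x - b x) / a x := by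
    rw [le_sub_comm, div_le_iff₀ hax]
    linarith
  have c2 : ε₀ / 2 ≤ 1 - K / 2 - x * b x / a x := by
    rw [le_sub_comm, div_le_iff₀ hax]
    linarith
  have p1 : 0 ≤ yt t x ^ 2 / sigW a b x := div_nonneg (sq_nonneg _) (h.sigW_pos hx').le
  have p2 : 0 ≤ etaW a b x * yx t x ^ 2 := mul_nonneg (etaW_pos a b x).le (sq_nonneg _)
  rw [energyDensity, mul_add]
  exact add_le_add (mul_le_mul_of_nonneg_right c1 p1) (mul_le_mul_of_nonneg_right c2 p2)

lemma multiplierFlux_cont (hy : ClassicalSol a b β y yt yx ytt ytx yxx)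
    (h : CoeffBounds a a' b K ε₀) {s T c : ℝ} (hs : 0 < s) (hc : 0 < c) :
    ContinuousOn (Function.uncurry (multiplierFlux a b K y yt yx)) (Icc s T ×ˢ Icc c 1) := by
  have hyx := hy.yx_cont (T := T) hs hc
  have hx : ContinuousOn (fun p : ℝ × ℝ => p.2) (Icc s T ×ˢ Icc c 1) := by fun_prop
  have hmaps : MapsTo (fun p : ℝ × ℝ => p.2) (Icc s T ×ˢ Icc c 1) (Icc 0 1) :=
    fun p hp => ⟨hc.le.trans hp.2.1, hp.2.2⟩
  have hη := h.etaW_cont.comp hx hmaps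
  exact ((hx.mul ((hη.mul hyx).mul hyx)).add (hx.mul (((hy.yt_cont hs hc).pow 2).div
    (h.sigW_cont.comp hx hmaps) fun p hp => (h.sigW_pos ⟨hc.trans_le hp.2.1, hp.2.2⟩).ne'))).sub
      (continuousOn_const.mul ((hy.y_cont hs hc).mul (hη.mul hyx)))

lemma integrableOn_multiplierFlux_sub (hy : ClassicalSol a b β y yt yx ytt ytx yxx)
    (h : CoeffBounds a a' b K ε₀) {s T c : ℝ} (hs : 0 < s) (hc : 0 < c) (hc1 : c < 1) :
    IntegrableOn (fun t => multiplierFlux a b K y yt yx t 1 - multiplierFlux a b K y yt yx t c)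
      (Ioo s T) := by
  have hF : ∀ x ∈ Icc c 1, ContinuousOn (fun t => multiplierFlux a b K y yt yx t x) (Icc s T) :=
    fun x hx => (hy.multiplierFlux_cont h hs hc).comp (f := fun t => (t, x)) (by fun_prop)
      fun t ht => ⟨ht, hx⟩
  exact ((hF 1 (right_mem_Icc.2 hc1.le)).sub
    (hF c (left_mem_Icc.2 hc1.le))).integrableOn_Icc.mono_set Ioo_subset_Icc_self

lemma multiplier_inequality (hy : ClassicalSol a b β y yt yx ytt ytx yxx)
    (h : CoeffBounds a a' b K ε₀) {s T c : ℝ} (hs : 0 < s) (hsT : s < T) (hc : 0 < c)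
    (hc1 : c < 1) :
    (∫ x in c..1, (multiplierDensity a b K y yt yx T x - multiplierDensity a b K y yt yx s x)) +
        ∫ t in s..T, ∫ x in c..1, ε₀ / 2 * energyDensity a b yt yx t x ≤
      ∫ t in s..T, (multiplierFlux a b K y yt yx t 1 - multiplierFlux a b K y yt yx t c) := by
  have hyc := hy.y_cont (T := T) hs hc
  have hyt := hy.yt_cont (T := T) hs hc
  have hyx := hy.yx_cont (T := T) hs hc
  have hytt := hy.cont_tt.mono (rect_subset (T := T) hs hc)
  have hytx := hy.cont_tx.mono (rect_subset (T := T) hs hc)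
  have hx : ContinuousOn (fun p : ℝ × ℝ => p.2) (Icc s T ×ˢ Icc c 1) := by fun_prop
  have hmaps : MapsTo (fun p : ℝ × ℝ => p.2) (Icc s T ×ˢ Icc c 1) (Icc 0 1) :=
    fun p hp => ⟨hc.le.trans hp.2.1, hp.2.2⟩
  have hσ := h.sigW_cont.comp hx hmaps
  have hη := h.etaW_cont.comp hx hmaps
  have hσ0 : ∀ p ∈ Icc s T ×ˢ Icc c 1, sigW a b p.2 ≠ 0 :=
    fun p hp => (h.sigW_pos ⟨hc.trans_le hp.2.1, hp.2.2⟩).ne'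
  refine integral_rect_le_of_deriv_le (R := multiplierFlux a b K y yt yx) hsT.le hc1.le
    (fun t ht x hx => hy.multiplierDensity_deriv (hs.trans_le ht.1) ⟨hc.trans_le hx.1, hx.2⟩)
    ?_ ?_ (hy.multiplierFlux_cont h hs hc) ?_
  · exact (((continuousOn_const.mul hx).mul ((hytt.mul hyx).add (hyt.mul hytx))).div hσ hσ0).sub
      ((continuousOn_const.mul ((hyt.pow 2).add (hyc.mul hytt))).div hσ hσ0)
  · exact continuousOn_const.mul (((hyt.pow 2).div hσ hσ0).add (hη.mul (hyx.pow 2)))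
  · intro t ht x hx
    have hx' : x ∈ Ioo (0:ℝ) 1 := ⟨hc.trans hx.1, hx.2⟩
    exact ⟨_, hy.multiplierFlux_deriv h (hs.trans_le ht.1) hx',
      add_le_add_right (energyDensity_le h hx') _⟩

lemma integrableOn_energyDensity (hy : ClassicalSol a b β y yt yx ytt ytx yxx)
    (h : CoeffBounds a a' b K ε₀) {t : ℝ} (ht : 0 ≤ t) :
    IntegrableOn (energyDensity a b yt yx t) (Ioo (0:ℝ) 1) :=
  (hy.integrableOn_yt ht).add (hy.integrableOn_yx h ht)

lemma abs_multiplierDensity_le (h : CoeffBounds a a' b K ε₀) {t x : ℝ} (hx : x ∈ Ioc (0:ℝ) 1) :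
    |multiplierDensity a b K y yt yx t x| ≤ (1 + K / 4) * (yt t x ^ 2 / sigW a b x) +
      1 / a 1 * (etaW a b x * yx t x ^ 2) + K / 4 * (y t x ^ 2 / sigW a b x) := by
  have hσ := h.sigW_pos hx
  have hη := etaW_pos a b x
  have ha := h.a_pos x hx
  have hK := h.K_pos
  have e1 : x ^ 2 * yx t x ^ 2 / sigW a b x = x ^ 2 / a x * (etaW a b x * yx t x ^ 2) := by
    rw [sigW]; field_simp
  have h1 : x ^ 2 * yx t x ^ 2 / sigW a b x ≤ 1 / a 1 * (etaW a b x * yx t x ^ 2) := by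
    rw [e1]
    exact mul_le_mul_of_nonneg_right (h.sq_div_le hx) (by positivity)
  have h2 : |2 * x * yt t x * yx t x| ≤ yt t x ^ 2 + x ^ 2 * yx t x ^ 2 := by
    rw [abs_le]
    constructor <;> nlinarith [sq_nonneg (yt t x + x * yx t x), sq_nonneg (yt t x - x * yx t x)]
  have h3 : |K / 2 * (y t x * yt t x)| ≤ K / 4 * (y t x ^ 2 + yt t x ^ 2) := by
    have : |2 * (y t x * yt t x)| ≤ y t x ^ 2 + yt t x ^ 2 := by
      rw [abs_le]
      constructor <;> nlinarith [sq_nonneg (y t x + yt t x), sq_nonneg (y t x - yt t x)]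
    calc |K / 2 * (y t x * yt t x)| = K / 4 * |2 * (y t x * yt t x)| := by
          rw [← abs_of_pos (show 0 < K / 4 by positivity)]
          rw [← abs_mul]
          congr 1; ring
      _ ≤ _ := by gcongr
  calc |multiplierDensity a b K y yt yx t x|
      ≤ |2 * x * yt t x * yx t x| / sigW a b x + |K / 2 * (y t x * yt t x)| / sigW a b x := by
        rw [multiplierDensity]
        refine (abs_sub _ _).trans ?_
        rw [abs_div, abs_div, abs_of_pos hσ]
    _ ≤ (yt t x ^ 2 + x ^ 2 * yx t x ^ 2) / sigW a b x +
        K / 4 * (y t x ^ 2 + yt t x ^ 2) / sigW a b x := by gcongr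
    _ = (1 + K / 4) * (yt t x ^ 2 / sigW a b x) + x ^ 2 * yx t x ^ 2 / sigW a b x +
        K / 4 * (y t x ^ 2 / sigW a b x) := by ring
    _ ≤ _ := by gcongr

lemma abs_integral_multiplierDensity_le (hy : ClassicalSol a b β y yt yx ytt ytx yxx)
    (h : CoeffBounds a a' b K ε₀) (hβ : 0 ≤ β) {C Θ : ℝ} (hC : 0 < C)
    (hHP : ∀ v v' : ℝ → ℝ, MemH1sig0 a b v v' →
      ∫ x in Ioo (0:ℝ) 1, (v x) ^ 2 / sigW a b x ≤ C * ∫ x in Ioo (0:ℝ) 1, (v' x) ^ 2)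
    (hΘ1 : 1 / a 1 + K * C / sInf (etaW a b '' Icc 0 1) ≤ Θ) (hΘ2 : 1 + K / 4 ≤ Θ)
    {t c : ℝ} (ht : 0 ≤ t) (hc : 0 < c) (hc1 : c < 1) :
    |∫ x in c..1, multiplierDensity a b K y yt yx t x| ≤ 2 * Θ * energy a b β y yt yx t := by
  obtain ⟨hm, hmle, -⟩ := h.etaW_bounds
  set m := sInf (etaW a b '' Icc 0 1)
  have hK := h.K_pos
  have hit := hy.integrableOn_yt ht
  have hix := hy.integrableOn_yx h ht
  have hiy := (hy.memH1sig0_y ht).l2sig.2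
  set g := fun x => (1 + K / 4) * (yt t x ^ 2 / sigW a b x) +
      1 / a 1 * (etaW a b x * yx t x ^ 2) + K / 4 * (y t x ^ 2 / sigW a b x) with hg
  have hg1 : IntegrableOn (fun x => (1 + K / 4) * (yt t x ^ 2 / sigW a b x) +
      1 / a 1 * (etaW a b x * yx t x ^ 2)) (Ioo 0 1) := (hit.const_mul _).add (hix.const_mul _)
  have hgi : IntegrableOn g (Ioo 0 1) := hg1.add (hiy.const_mul _)
  have hsub : Ioo c 1 ⊆ Ioo 0 1 := Ioo_subset_Ioo_left hc.le
  have h1 : |∫ x in c..1, multiplierDensity a b K y yt yx t x| ≤ ∫ x in c..1, g x := by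
    refine intervalIntegral.norm_integral_le_of_norm_le (μ := volume)
      (f := multiplierDensity a b K y yt yx t) (g := g) hc1.le
      (Eventually.of_forall fun x hx => ?_) ?_
    · exact abs_multiplierDensity_le h ⟨hc.trans hx.1, hx.2⟩
    · exact (intervalIntegrable_iff_integrableOn_Ioo_of_le hc1.le).2 (hgi.mono_set hsub)
  have h2 : ∫ x in c..1, g x ≤ ∫ x in Ioo (0:ℝ) 1, g x := by
    rw [intervalIntegral.integral_of_le hc1.le, integral_Ioc_eq_integral_Ioo]
    refine setIntegral_mono_set hgi ?_ hsub.eventuallyLE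
    refine (ae_restrict_iff' measurableSet_Ioo).2 (Eventually.of_forall fun x hx => ?_)
    exact (abs_nonneg _).trans (abs_multiplierDensity_le h (Ioo_subset_Ioc_self hx))
  have h3 : ∫ x in Ioo (0:ℝ) 1, g x = (1 + K / 4) * (∫ x in Ioo (0:ℝ) 1, yt t x ^ 2 / sigW a b x) +
      1 / a 1 * (∫ x in Ioo (0:ℝ) 1, etaW a b x * yx t x ^ 2) +
      K / 4 * ∫ x in Ioo (0:ℝ) 1, y t x ^ 2 / sigW a b x := by
    rw [hg, integral_add hg1 (hiy.const_mul _), integral_add (hit.const_mul _) (hix.const_mul _)]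
    simp only [integral_const_mul]
  have h4 : ∫ x in Ioo (0:ℝ) 1, yx t x ^ 2 ≤
      1 / m * ∫ x in Ioo (0:ℝ) 1, etaW a b x * yx t x ^ 2 := by
    rw [← integral_const_mul]
    refine setIntegral_mono_on (hy.regx t ht).deriv_sq_int (hix.const_mul _) measurableSet_Ioo ?_
    intro x hx
    rw [← mul_assoc, one_div_mul_eq_div]
    refine le_mul_of_one_le_left (sq_nonneg _) ?_
    exact (one_le_div hm).2 (hmle x (Ioo_subset_Icc_self hx))
  have h5 := hHP _ _ (hy.memH1sig0_y ht)
  have hE : energy a b β y yt yx t = 1 / 2 * ((∫ x in Ioo (0:ℝ) 1, yt t x ^ 2 / sigW a b x) +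
      (∫ x in Ioo (0:ℝ) 1, etaW a b x * yx t x ^ 2) + β * y t 1 ^ 2) := by
    rw [energy, integral_add hit hix]
  have hA : 0 ≤ ∫ x in Ioo (0:ℝ) 1, yt t x ^ 2 / sigW a b x :=
    setIntegral_nonneg measurableSet_Ioo fun x hx =>
      div_nonneg (sq_nonneg _) (h.sigW_pos (Ioo_subset_Ioc_self hx)).le
  have hB : 0 ≤ ∫ x in Ioo (0:ℝ) 1, etaW a b x * yx t x ^ 2 :=
    setIntegral_nonneg measurableSet_Ioo fun x hx =>
      mul_nonneg (etaW_pos a b x).le (sq_nonneg _)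
  set A := ∫ x in Ioo (0:ℝ) 1, yt t x ^ 2 / sigW a b x
  set B := ∫ x in Ioo (0:ℝ) 1, etaW a b x * yx t x ^ 2
  have h6 : K / 4 * ∫ x in Ioo (0:ℝ) 1, y t x ^ 2 / sigW a b x ≤ K * C / m * B := by
    calc K / 4 * ∫ x in Ioo (0:ℝ) 1, y t x ^ 2 / sigW a b x
        ≤ K / 4 * (C * (1 / m * B)) := by gcongr; exact h5.trans (by gcongr)
      _ = 1 / 4 * (K * C / m * B) := by ring
      _ ≤ K * C / m * B := by
        have : 0 ≤ K * C / m * B := by positivity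
        linarith
  have hΘ0 : 0 ≤ Θ := by linarith
  calc |∫ x in c..1, multiplierDensity a b K y yt yx t x|
      ≤ (1 + K / 4) * A + (1 / a 1 + K * C / m) * B := by
        rw [add_mul (1 / a 1)]; linarith
    _ ≤ Θ * A + Θ * B := by gcongr
    _ ≤ Θ * (A + B + β * y t 1 ^ 2) := by
        have : 0 ≤ Θ * (β * y t 1 ^ 2) := by positivity
        linarith
    _ = 2 * Θ * energy a b β y yt yx t := by rw [hE]; ring

lemma multiplierFlux_one_le (hy : ClassicalSol a b β y yt yx ytt ytx yxx)
    (h : CoeffBounds a a' b K ε₀) (hβ : 0 ≤ β) {t : ℝ} (ht : 0 < t) :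
    multiplierFlux a b K y yt yx t 1 ≤
      (1 / sigW a b 1 + 1 / etaW a b 1 + β / etaW a b 1 + K / 4) * yt t 1 ^ 2 +
        (β ^ 2 / etaW a b 1 + K * β / 2 + β / etaW a b 1 + K / 4) * y t 1 ^ 2 := by
  have hη := etaW_pos a b 1
  have hK := h.K_pos
  have e : yx t 1 = -(yt t 1 + β * y t 1) / etaW a b 1 := by
    rw [eq_div_iff hη.ne']
    linarith [hy.bc1 t ht]
  have key : (1 / sigW a b 1 + 1 / etaW a b 1 + β / etaW a b 1 + K / 4) * yt t 1 ^ 2 +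
        (β ^ 2 / etaW a b 1 + K * β / 2 + β / etaW a b 1 + K / 4) * y t 1 ^ 2 -
      multiplierFlux a b K y yt yx t 1 = (β / etaW a b 1 + K / 4) * (yt t 1 - y t 1) ^ 2 := by
    rw [multiplierFlux, e]
    field_simp
    ring
  have : 0 ≤ (β / etaW a b 1 + K / 4) * (yt t 1 - y t 1) ^ 2 := by positivity
  linarith

lemma exists_neg_multiplierFlux_le (hy : ClassicalSol a b β y yt yx ytt ytx yxx)
    (h : CoeffBounds a a' b K ε₀) : ∃ C : ℝ, ∀ t, 0 ≤ t → ∀ c ∈ Ioo (0:ℝ) 1,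
      -multiplierFlux a b K y yt yx t c ≤ C * ((∫ x in Ioo 0 1, energyDensity a b yt yx t x) -
        ∫ x in Ioo c 1, energyDensity a b yt yx t x) := by
  obtain ⟨hm, hmle, M, hM⟩ := h.etaW_bounds
  set m := sInf (etaW a b '' Icc 0 1)
  have hM0 : 0 ≤ M := (etaW_pos a b 0).le.trans (hM 0 (left_mem_Icc.2 zero_le_one))
  refine ⟨M * (1 / m), fun t ht c hc => ?_⟩
  have hc0 : 0 < c := hc.1
  have hie := hy.integrableOn_energyDensity h ht
  have hsub : Ioo 0 c ⊆ Ioo (0:ℝ) 1 := Ioo_subset_Ioo_right hc.2.le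
  have hei : IntervalIntegrable (energyDensity a b yt yx t) volume 0 1 :=
    (intervalIntegrable_iff_integrableOn_Ioo_of_le zero_le_one).2 hie
  have hsplit : (∫ x in Ioo 0 1, energyDensity a b yt yx t x) -
        ∫ x in Ioo c 1, energyDensity a b yt yx t x =
        ∫ x in Ioo 0 c, energyDensity a b yt yx t x := by
    have := intervalIntegral.integral_add_adjacent_intervals
      ((intervalIntegrable_iff_integrableOn_Ioo_of_le hc0.le).2 (hie.mono_set hsub))
      ((intervalIntegrable_iff_integrableOn_Ioo_of_le hc.2.le).2
        (hie.mono_set (Ioo_subset_Ioo_left hc0.le)))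
    rw [intervalIntegral.integral_of_le hc0.le, intervalIntegral.integral_of_le hc.2.le,
      intervalIntegral.integral_of_le zero_le_one] at this
    simp only [integral_Ioc_eq_integral_Ioo] at this
    linarith
  have hle : ∫ x in Ioo 0 c, yx t x ^ 2 ≤ 1 / m * ∫ x in Ioo 0 c, energyDensity a b yt yx t x := by
    rw [← integral_const_mul]
    refine setIntegral_mono_on ((hy.regx t ht).deriv_sq_int.mono_set hsub)
      ((hie.mono_set hsub).const_mul _) measurableSet_Ioo fun x hx => ?_
    have hx1 := hsub hx
    have h1 : 0 ≤ yt t x ^ 2 / sigW a b x :=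
      div_nonneg (sq_nonneg _) (h.sigW_pos (Ioo_subset_Ioc_self hx1)).le
    have h2 : m * yx t x ^ 2 ≤ etaW a b x * yx t x ^ 2 :=
      mul_le_mul_of_nonneg_right (hmle x (Ioo_subset_Icc_self hx1)) (sq_nonneg _)
    rw [one_div_mul_eq_div, le_div_iff₀ hm, energyDensity]
    linarith
  have hcm := Ioo_subset_Ioc_self hc
  have hsq := (hy.memH1sig0_y ht).sq_le (hy.yx_cont_x ht) hcm
  have hη := etaW_pos a b c
  have hσ := h.sigW_pos hcm
  have hK := h.K_pos
  have h1 : -multiplierFlux a b K y yt yx t c ≤ etaW a b c * (y t c ^ 2 / c) := by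
    have hpos : 0 ≤ c * (yt t c ^ 2 / sigW a b c) := by positivity
    have hyoung : K / 2 * (y t c * yx t c) ≤ c * yx t c ^ 2 + y t c ^ 2 / c := by
      have e : c * yx t c ^ 2 + y t c ^ 2 / c - K / 2 * (y t c * yx t c) =
          c * (yx t c - K / 4 * (y t c / c)) ^ 2 + (1 - K ^ 2 / 16) * (y t c ^ 2 / c) := by
        field_simp
        ring
      have h16 : 0 ≤ 1 - K ^ 2 / 16 := by nlinarith [h.K_lt]
      have : 0 ≤ c * (yx t c - K / 4 * (y t c / c)) ^ 2 + (1 - K ^ 2 / 16) * (y t c ^ 2 / c) := by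
        positivity
      linarith
    have := mul_le_mul_of_nonneg_left hyoung hη.le
    rw [multiplierFlux]
    linarith
  have h2 : y t c ^ 2 / c ≤ ∫ x in Ioo 0 c, yx t x ^ 2 := by
    rw [div_le_iff₀ hc0]; linarith
  calc -multiplierFlux a b K y yt yx t c ≤ etaW a b c * (y t c ^ 2 / c) := h1
    _ ≤ M * (1 / m * ∫ x in Ioo 0 c, energyDensity a b yt yx t x) :=
        mul_le_mul (hM c (Ioo_subset_Icc_self hc)) (h2.trans hle) (by positivity) hM0
    _ = _ := by rw [hsplit]; ring

end ClassicalSol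

lemma tendsto_iterated_setIntegral {f : ℝ × ℝ → ℝ} {s T : ℝ}
    (hf : IntegrableOn f (Ioo s T ×ˢ Ioo (0:ℝ) 1)) :
    Tendsto (fun n : ℕ => ∫ t in Ioo s T, ∫ x in Ioo (1 / ((n : ℝ) + 2)) 1, f (t, x)) atTop
      (𝓝 (∫ t in Ioo s T, ∫ x in Ioo (0:ℝ) 1, f (t, x))) := by
  have hU : ⋃ n : ℕ, Ioo s T ×ˢ Ioo (1 / ((n : ℝ) + 2)) 1 = Ioo s T ×ˢ Ioo (0:ℝ) 1 := by
    rw [← prod_iUnion]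
    congr 1
    ext x
    simp only [mem_iUnion, mem_Ioo, exists_and_right, and_congr_left_iff]
    intro _
    constructor
    · rintro ⟨n, hn⟩
      exact lt_trans (by positivity) hn
    · intro hx
      obtain ⟨n, hn⟩ := exists_nat_one_div_lt hx
      exact ⟨n, lt_trans (one_div_lt_one_div_of_lt (by positivity) (by linarith)) hn⟩
  have h := tendsto_setIntegral_of_monotone (μ := volume) (f := f)
    (s := fun n : ℕ => Ioo s T ×ˢ Ioo (1 / ((n : ℝ) + 2)) 1)
    (fun n => measurableSet_Ioo.prod measurableSet_Ioo) (fun n k hnk => ?_) (by rwa [hU])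
  · rw [hU, Measure.volume_eq_prod, setIntegral_prod _ hf] at h
    refine h.congr fun n => ?_
    refine setIntegral_prod _ (hf.mono_set (prod_mono subset_rfl (Ioo_subset_Ioo_left ?_)))
    positivity
  · refine prod_mono subset_rfl (Ioo_subset_Ioo_left ?_)
    have : (n : ℝ) ≤ k := by exact_mod_cast hnk
    gcongr

lemma integrableOn_iterated_setIntegral {f : ℝ × ℝ → ℝ} {s T c : ℝ} (hc : 0 ≤ c)
    (hf : IntegrableOn f (Ioo s T ×ˢ Ioo (0:ℝ) 1)) :
    IntegrableOn (fun t => ∫ x in Ioo c 1, f (t, x)) (Ioo s T) := by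
  have h := hf.mono_set (prod_mono (subset_refl (Ioo s T)) (Ioo_subset_Ioo_left (b := 1) hc))
  rw [IntegrableOn, Measure.volume_eq_prod, ← Measure.prod_restrict] at h
  exact h.integral_prod_left

/-- The energy estimate of Proposition 3.6. -/
theorem stmt17 (a a' b : ℝ → ℝ) (K β C_HP ε₀ Θ : ℝ)
    (y yt yx ytt ytx yxx : ℝ → ℝ → ℝ)
    (hH2 : HypH2 a a' b K ε₀) (hβ : 0 ≤ β) (hC_HP : 0 < C_HP)
    (hHP : ∀ v v' : ℝ → ℝ, MemH1sig0 a b v v' →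
      ∫ x in Set.Ioo (0:ℝ) 1, (v x) ^ 2 / sigW a b x ≤
        C_HP * ∫ x in Set.Ioo (0:ℝ) 1, (v' x) ^ 2)
    (hΘ : Θ = max (1 / a 1 + K * C_HP / sInf (etaW a b '' Set.Icc 0 1)) (1 + K / 4))
    (hy : ClassicalSol a b β y yt yx ytt ytx yxx) :
    ∀ s T : ℝ, 0 < s → s < T →
      (ε₀ / 2) * (∫ t in Set.Ioo s T, ∫ x in Set.Ioo (0:ℝ) 1,
          ((yt t x) ^ 2 / sigW a b x + etaW a b x * (yx t x) ^ 2)) ≤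
        4 * Θ * energy a b β y yt yx s
        + (1 / sigW a b 1 + 1 / etaW a b 1 + β / etaW a b 1 + K / 4) *
            (energy a b β y yt yx s - energy a b β y yt yx T)
        + (β ^ 2 / etaW a b 1 + K * β / 2 + β / etaW a b 1 + K / 4) *
            ∫ t in Set.Ioo s T, (y t 1) ^ 2 := by
  obtain h := hH2.coeffBounds
  have hΘ1 : 1 / a 1 + K * C_HP / sInf (etaW a b '' Set.Icc 0 1) ≤ Θ := hΘ ▸ le_max_left _ _
  have hΘ2 : 1 + K / 4 ≤ Θ := hΘ ▸ le_max_right _ _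
  intro s T hs hsT
  have hT : 0 < T := hs.trans hsT
  obtain ⟨C, hC⟩ := hy.exists_neg_multiplierFlux_le h
  set e := ClassicalSol.energyDensity a b yt yx
  set E := energy a b β y yt yx
  set A := 1 / sigW a b 1 + 1 / etaW a b 1 + β / etaW a b 1 + K / 4
  set B := β ^ 2 / etaW a b 1 + K * β / 2 + β / etaW a b 1 + K / 4
  set Y := ∫ t in Set.Ioo s T, (y t 1) ^ 2
  change ε₀ / 2 * (∫ t in Ioo s T, ∫ x in Ioo (0:ℝ) 1, e t x) ≤ 4 * Θ * E s + A * (E s - E T) + B * Y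
  have hei : IntegrableOn (fun p : ℝ × ℝ => e p.1 p.2) (Ioo s T ×ˢ Ioo (0:ℝ) 1) :=
    (hy.intQ s T hs hsT).1.add (hy.intQ s T hs hsT).2
  have hdiss : ∫ t in s..T, yt t 1 ^ 2 = E s - E T := hy.integral_boundary_velocity h hs hsT
  have hET : E T ≤ E s := by
    have : 0 ≤ ∫ t in s..T, yt t 1 ^ 2 :=
      intervalIntegral.integral_nonneg hsT.le fun t _ => sq_nonneg _
    linarith
  have hlim := tendsto_iterated_setIntegral hei
  set I := ∫ t in Ioo s T, ∫ x in Ioo (0:ℝ) 1, e t x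
  have hstep : ∀ n : ℕ, ε₀ / 2 * (∫ t in Ioo s T, ∫ x in Ioo (1 / ((n : ℝ) + 2)) 1, e t x) ≤
      4 * Θ * E s + A * (E s - E T) + B * Y +
        C * (I - ∫ t in Ioo s T, ∫ x in Ioo (1 / ((n : ℝ) + 2)) 1, e t x) := by
    intro n
    have hc0 : 0 < 1 / ((n : ℝ) + 2) := by positivity
    have hc1 : 1 / ((n : ℝ) + 2) < 1 := by
      rw [div_lt_one (by positivity)]
      linarith [(Nat.cast_nonneg n : (0:ℝ) ≤ n)]
    set c := 1 / ((n : ℝ) + 2)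
    have hmul : (∫ x in c..1, (ClassicalSol.multiplierDensity a b K y yt yx T x -
          ClassicalSol.multiplierDensity a b K y yt yx s x)) +
        ∫ t in s..T, ∫ x in c..1, ε₀ / 2 * e t x ≤ _ := hy.multiplier_inequality h hs hsT hc0 hc1
    have hPi : ∀ t, 0 ≤ t →
        IntervalIntegrable (ClassicalSol.multiplierDensity a b K y yt yx t) volume c 1 := by
      intro t ht
      have hsub : Icc c 1 ⊆ Ioc 0 1 := fun x hx => ⟨hc0.trans_le hx.1, hx.2⟩
      have hσ := h.sigW_cont.mono (hsub.trans Ioc_subset_Icc_self)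
      have hσ0 : ∀ x ∈ Icc c 1, sigW a b x ≠ 0 := fun x hx => (h.sigW_pos (hsub hx)).ne'
      have hyt := (hy.yt_cont_x ht).mono hsub
      have hyx := (hy.yx_cont_x ht).mono hsub
      have hyc := (hy.y_cont_x ht).mono hsub
      refine ContinuousOn.intervalIntegrable ?_
      rw [uIcc_of_le hc1.le]
      exact (((((continuousOn_const (c := (2:ℝ))).mul continuousOn_id).mul hyt).mul hyx).div
        hσ hσ0).sub (((continuousOn_const (c := K / 2)).mul (hyc.mul hyt)).div hσ hσ0)
    rw [intervalIntegral.integral_sub (hPi T hT.le) (hPi s hs.le)] at hmul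
    have hPs : |∫ x in c..1, ClassicalSol.multiplierDensity a b K y yt yx s x| ≤
        2 * Θ * E s :=
      (hy.abs_integral_multiplierDensity_le h hβ hC_HP hHP hΘ1 hΘ2 hs.le hc0 hc1)
    have hPT : |∫ x in c..1, ClassicalSol.multiplierDensity a b K y yt yx T x| ≤
        2 * Θ * E T :=
      (hy.abs_integral_multiplierDensity_le h hβ hC_HP hHP hΘ1 hΘ2 hT.le hc0 hc1)
    have hee : ∫ t in s..T, ∫ x in c..1, ε₀ / 2 * e t x =
        ε₀ / 2 * ∫ t in Ioo s T, ∫ x in Ioo c 1, e t x := by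
      simp only [integral_const_mul, intervalIntegral.integral_of_le hsT.le,
        intervalIntegral.integral_of_le hc1.le, integral_Ioc_eq_integral_Ioo]
    obtain ⟨hbt, -, hby⟩ := hy.intBdry s T hs hsT
    have hi0 := integrableOn_iterated_setIntegral le_rfl hei
    have hic := integrableOn_iterated_setIntegral hc0.le hei
    have hgi1 : IntegrableOn (fun t => A * yt t 1 ^ 2 + B * y t 1 ^ 2) (Ioo s T) :=
      (hbt.const_mul A).add (hby.const_mul B)
    have hgi2 : IntegrableOn (fun t => C * ((∫ x in Ioo (0:ℝ) 1, e t x) -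
        ∫ x in Ioo c 1, e t x)) (Ioo s T) := (hi0.sub hic).const_mul C
    have hflux : ∫ t in s..T, (ClassicalSol.multiplierFlux a b K y yt yx t 1 -
          ClassicalSol.multiplierFlux a b K y yt yx t c) ≤
        A * (E s - E T) + B * Y + C * (I - ∫ t in Ioo s T, ∫ x in Ioo c 1, e t x) := by
      have hval : ∫ t in Ioo s T, (A * yt t 1 ^ 2 + B * y t 1 ^ 2 +
          C * ((∫ x in Ioo (0:ℝ) 1, e t x) - ∫ x in Ioo c 1, e t x)) =
          A * (E s - E T) + B * Y + C * (I - ∫ t in Ioo s T, ∫ x in Ioo c 1, e t x) := by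
        rw [integral_add hgi1 hgi2, integral_add (hbt.const_mul A) (hby.const_mul B),
          integral_const_mul, integral_const_mul, integral_const_mul, integral_sub hi0 hic,
          ← hdiss, intervalIntegral.integral_of_le hsT.le, integral_Ioc_eq_integral_Ioo]
      rw [← hval, intervalIntegral.integral_of_le hsT.le, integral_Ioc_eq_integral_Ioo]
      refine setIntegral_mono_on ?_ (hgi1.add hgi2) measurableSet_Ioo fun t ht => ?_
      · exact hy.integrableOn_multiplierFlux_sub h hs hc0 hc1
      · have h1 : ClassicalSol.multiplierFlux a b K y yt yx t 1 ≤
            A * yt t 1 ^ 2 + B * y t 1 ^ 2 :=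
          hy.multiplierFlux_one_le h hβ (hs.trans ht.1)
        have h2 : -ClassicalSol.multiplierFlux a b K y yt yx t c ≤
            C * ((∫ x in Ioo (0:ℝ) 1, e t x) - ∫ x in Ioo c 1, e t x) := hC t (hs.trans ht.1).le c ⟨hc0, hc1⟩
        linarith
    have hΘE : 2 * Θ * E T ≤ 2 * Θ * E s := by
      have : 0 ≤ 2 * Θ := by linarith [h.K_pos]
      exact mul_le_mul_of_nonneg_left hET this
    rw [hee] at hmul
    linarith [(abs_le.1 hPs).2, (abs_le.1 hPT).1]
  have := le_of_tendsto_of_tendsto' (hlim.const_mul (ε₀ / 2))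
    (((hlim.const_sub I).const_mul C).const_add (4 * Θ * E s + A * (E s - E T) + B * Y)) hstep
  simpa using this
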